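/- Let m ≥ 2. Then Alt_{2m} S I(0; 0, ρ_1, ρ_2, …, ρ_{m−1}; ρ_m) = Alt_{2m}[ Σ_{j=1}^m w_j ] in V_F^{⊗m}, where w_j is the elementary tensor with m slots whose j-th slot counted from the right is [ρ_j], and whose remaining m−1 slots, read from left to right, are [1 − ρ_m/ρ_{m−1}], [1 − ρ_{m−1}/ρ_{m−2}], …, [1 − ρ_2/ρ_1] in this order. -/

import Mathlib

open scoped TensorProduct
open PiTensorProduct

attribute [local instance] Classical.propDecidable

set_option maxHeartbeats 1000000
set_option synthInstance.maxHeartbeats 400000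

noncomputable section

namespace GrassPoly

variable (F : Type) [Field F]

/-- `V_F = F^× ⊗_ℤ ℚ` as a `ℚ`-vector space. -/
abbrev VF : Type := ℚ ⊗[ℤ] (Additive Fˣ)

variable {F}

/-- The class `[a]` of a nonzero field element in `V_F` (defined to be `0` for `a = 0`). -/
def cls (a : F) : VF F :=
  if h : a = 0 then 0 else (1 : ℚ) ⊗ₜ[ℤ] (Additive.ofMul (Units.mk0 a h))

variable (F) in
/-- Tensor powers of V_F over ℚ. -/
abbrev TP (n : ℕ) : Type := ⨂[ℚ]^n (VF F)

instance instTPAddCommGroup (n : ℕ) : AddCommGroup (TP F n) :=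
  Module.addCommMonoidToAddCommGroup ℚ

/-- Appending one extra tensor factor on the right. -/
def snoc {n : ℕ} : TP F n →ₗ[ℚ] VF F →ₗ[ℚ] TP F (n + 1) :=
  PiTensorProduct.lift
    ((PiTensorProduct.tprod ℚ (s := fun _ : Fin (n + 1) => VF F)).curryRight)

/-- The factor `t_i` appearing in the recursive definition of the symbol,
as a function of `(a_{i-1}, a_i, a_{i+1})`. -/
def tCoef (p a q : F) : VF F :=
  if p = a then (if a = q then 0 else cls (q - a))
  else if a = q then - cls (p - a)
  else cls ((q - a) / (p - a))

/-- The symbol `S I(a₀; a₁, …, a_m; a_{m+1})`, with the middle entries given as a list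
(of length `n`). -/
def SIaux : (n : ℕ) → (a0 : F) → (as : List F) → (b : F) → as.length = n → TP F n
  | 0, _, _, _, _ => tprod ℚ (fun i : Fin 0 => i.elim0)
  | n + 1, a0, as, b, h =>
      ∑ i : Fin (n + 1),
        snoc (SIaux n a0 (as.eraseIdx i.val) b
            (by
              have hi' := i.isLt
              have hi : i.val < as.length := by omega
              have h2 := List.length_eraseIdx_of_lt hi
              omega))
          (tCoef ((a0 :: as).getD i.val 0) (as.getD i.val 0) ((as ++ [b]).getD (i.val + 1) 0))

/-- Cyclic rotation `b₁ ⊗ … ⊗ b_N ↦ b₂ ⊗ … ⊗ b_N ⊗ b₁` on tensor powers. -/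
def rotN (n : ℕ) : TP F n ≃ₗ[ℚ] TP F n :=
  PiTensorProduct.reindex ℚ (fun _ : Fin n => VF F) (finRotate n).symm

/-- Splitting off the last tensor factor. -/
def splitLast (n : ℕ) : TP F (n + 1) ≃ₗ[ℚ] (TP F n) ⊗[ℚ] (VF F) :=
  ((PiTensorProduct.reindex ℚ (fun _ : Fin (n + 1) => VF F)
      (finSumFinEquiv (m := n) (n := 1)).symm).trans
    (PiTensorProduct.tmulEquiv ℚ (VF F)).symm).trans
    (TensorProduct.congr (LinearEquiv.refl ℚ _)
      (PiTensorProduct.subsingletonEquiv (0 : Fin 1)))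

/-- The projector `Π̃_N` annihilating symbols of products. -/
def Pit : (n : ℕ) → TP F n →ₗ[ℚ] TP F n
  | 0 => LinearMap.id
  | 1 => LinearMap.id
  | (n + 2) =>
      ((splitLast (n + 1)).symm.toLinearMap
        ∘ₗ TensorProduct.map (Pit (n + 1)) LinearMap.id
        ∘ₗ (splitLast (n + 1)).toLinearMap)
      ∘ₗ ((LinearMap.id : TP F (n + 2) →ₗ[ℚ] TP F (n + 2)) - (rotN (F := F) (n + 2)).toLinearMap)

/-- The map on `V_F` induced by a field automorphism. -/
def vmap (φ : F ≃+* F) : VF F →ₗ[ℚ] VF F :=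
  TensorProduct.AlgebraTensorModule.map (LinearMap.id : ℚ →ₗ[ℚ] ℚ)
    (AddMonoidHom.toIntLinearMap
      { toFun := fun a => Additive.ofMul ((Units.map (φ : F →* F)) a.toMul)
        map_zero' := by simp
        map_add' := by intro a b; simp [_root_.map_mul] })

/-- The induced map on tensor powers. -/
def tpMap {n : ℕ} (φ : F ≃+* F) : TP F n →ₗ[ℚ] TP F n :=
  PiTensorProduct.map (fun _ => vmap φ)


/-! ### Symbols of (multiple) polylogarithms -/

/-- Symbol of `Li₂`. -/
def SLi2 (x : F) : TP F 2 := - SIaux 2 0 [x⁻¹, 0] 1 rfl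

/-- Symbol of `Li₃`. -/
def SLi3 (x : F) : TP F 3 := - SIaux 3 0 [x⁻¹, 0, 0] 1 rfl

/-- Symbol of `Li₄`. -/
def SLi4 (x : F) : TP F 4 := - SIaux 4 0 [x⁻¹, 0, 0, 0] 1 rfl

/-- Symbol of `Li₅`. -/
def SLi5 (x : F) : TP F 5 := - SIaux 5 0 [x⁻¹, 0, 0, 0, 0] 1 rfl

/-- Symbol of `I_{3,1}(x,y) = I(0; x,0,0,y; 1)`. -/
def SI31 (x y : F) : TP F 4 := SIaux 4 0 [x, 0, 0, y] 1 rfl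

/-- Symbol of `I_{4,1}(x,y) = I(0; x,0,0,0,y; 1)`. -/
def SI41 (x y : F) : TP F 5 := SIaux 5 0 [x, 0, 0, 0, y] 1 rfl

/-- Symbol of `I⁺_{4,1}(x,y) = ½ (I_{4,1}(x,y) + I_{4,1}(x,y⁻¹))`. -/
def I41p (x y : F) : TP F 5 := (2 : ℚ)⁻¹ • (SI41 x y + SI41 x y⁻¹)

/-- The anharmonic orbit of `x`, together with the signs of the
corresponding permutations in `S₃`. -/
def anhList (x : F) : List (ℚ × F) :=
  [(1, x), (1, (1 - x)⁻¹), (1, 1 - x⁻¹), (-1, x⁻¹), (-1, 1 - x), (-1, x / (x - 1))]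

/-- Symbol of `Ĩ_{3,1}(x,y) = (1/36) Σ_{σ,π ∈ S₃} sgn(σ) sgn(π) I_{3,1}(x^σ, y^π)`. -/
def tI31 (x y : F) : TP F 4 :=
  (36 : ℚ)⁻¹ •
    ((anhList x).map (fun p =>
      ((anhList y).map (fun q => (p.1 * q.1) • SI31 p.2 q.2)).sum)).sum

/-- Symbol of `Ĩ⁺_{4,1}(x,y) = (1/6) Σ_{σ ∈ S₃} sgn(σ) I⁺_{4,1}(x^σ, y)`. -/
def tI41p (x y : F) : TP F 5 :=
  (6 : ℚ)⁻¹ • ((anhList x).map (fun p => p.1 • I41p p.2 y)).sum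

/-- Symbol of `V(z; x, y) = Ĩ_{3,1}(z, [x]+[y]+[(1-x)/(1-xy)]+[1-xy]+[(1-y)/(1-xy)])`. -/
def Vc (z x y : F) : TP F 4 :=
  tI31 z x + tI31 z y + tI31 z ((1 - x) / (1 - x * y)) + tI31 z (1 - x * y)
    + tI31 z ((1 - y) / (1 - x * y))

/-- `Sym₃₆(a,b) := I_{3,1}(a,b) - Ĩ_{3,1}(a,b)` (on the level of symbols). -/
def S36 (a b : F) : TP F 4 := SI31 a b - tI31 a b

/-! ### Generic vectors -/

variable (N m : ℕ)

/-- Polynomial ring on the entries of `N` generic vectors in `m`-space. -/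
abbrev Pol : Type := MvPolynomial (Fin N × Fin m) ℚ

/-- The field of rational functions in the entries of `N` generic vectors in `m`-space. -/
abbrev FF : Type := FractionRing (Pol N m)

/-- The `j`-th coordinate of the `i`-th generic vector. -/
def gen (i : Fin N) (j : Fin m) : FF N m :=
  algebraMap (Pol N m) (FF N m) (MvPolynomial.X (i, j))

/-- `⟨i₁ … i_m⟩`: the determinant of the matrix whose columns are
the generic vectors selected by `cols`. -/
def dets (cols : Fin m → Fin N) : FF N m :=
  (Matrix.of fun r c => gen N m (cols c) r).det

/-- The field automorphism of `FF N m` induced by a permutation of the `N` vectors. -/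
def permAut (σ : Equiv.Perm (Fin N)) : FF N m ≃+* FF N m :=
  IsFractionRing.ringEquivOfRingEquiv
    ((MvPolynomial.renameEquiv ℚ (σ.prodCongr (Equiv.refl (Fin m)))).toRingEquiv)

variable {N m}

/-- Skew-symmetrization over all permutations of the `N` generic vectors. -/
def Alt {n : ℕ} (x : TP (FF N m) n) : TP (FF N m) n :=
  ∑ σ : Equiv.Perm (Fin N), (((Equiv.Perm.sign σ : ℤˣ) : ℤ) : ℚ) • tpMap (permAut N m σ) x

end GrassPoly

end

namespace GrassPoly

noncomputable section GenWeight

/-- An index in `Fin (2k+4)`, from a `0`-based natural number. -/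
def fin2m (k : ℕ) (x : ℕ) : Fin (2 * k + 4) := ⟨x % (2 * k + 4), Nat.mod_lt _ (by omega)⟩

/-- Determinants of `m = k+2` of the `2m` generic vectors in `m`-space. -/
def gdet (k : ℕ) (cols : Fin (k + 2) → Fin (2 * k + 4)) : FF (2 * k + 4) (k + 2) :=
  dets (2 * k + 4) (k + 2) cols

/-- `ρ_i = ⟨i, i+1, …, i+m-2, 2m-1⟩ / ⟨i, i+1, …, i+m-2, 2m⟩` (1-based labels, `m = k+2`). -/
def grho (k i : ℕ) : FF (2 * k + 4) (k + 2) :=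
  gdet k (fun t => if t.val < k + 1 then fin2m k (i - 1 + t.val) else fin2m k (2 * k + 2)) /
    gdet k (fun t => if t.val < k + 1 then fin2m k (i - 1 + t.val) else fin2m k (2 * k + 3))

/-- `S(Gr_m) = 2·(-1)^m·(m!)²·Alt_{2m}[⟨1,…,m⟩ ⊗ ⟨2,…,m+1⟩ ⊗ ⋯ ⊗ ⟨m,…,2m-1⟩]`, `m = k+2`. -/
def SGrm (k : ℕ) : TP (FF (2 * k + 4) (k + 2)) (k + 2) :=
  ((2 : ℚ) * (-1 : ℚ) ^ (k + 2) * ((Nat.factorial (k + 2) : ℚ)) ^ 2) •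
    Alt (tprod ℚ (fun j : Fin (k + 2) => cls (gdet k (fun c => fin2m k (j.val + c.val)))))

end GenWeight

end GrassPoly

open GrassPoly


namespace GrassPoly

section Symbols

variable {F : Type} [Field F]

theorem cls_of_ne_zero {a : F} (ha : a ≠ 0) :
    cls a = (1 : ℚ) ⊗ₜ[ℤ] (Additive.ofMul (Units.mk0 a ha)) := dif_neg ha

theorem cls_mul {a b : F} (ha : a ≠ 0) (hb : b ≠ 0) : cls (a * b) = cls a + cls b := by
  rw [cls_of_ne_zero ha, cls_of_ne_zero hb, cls_of_ne_zero (mul_ne_zero ha hb),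
    ← TensorProduct.tmul_add, ← ofMul_mul, Units.mk0_mul]

theorem cls_one : cls (1 : F) = 0 := by
  have h := cls_mul (one_ne_zero (α := F)) (one_ne_zero (α := F))
  rw [mul_one] at h
  simpa using h

theorem cls_div {a b : F} (ha : a ≠ 0) (hb : b ≠ 0) : cls (a / b) = cls a - cls b := by
  rw [eq_sub_iff_add_eq, ← cls_mul (div_ne_zero ha hb) hb, div_mul_cancel₀ _ hb]

theorem cls_neg (a : F) : cls (-a) = cls a := by
  by_cases ha : a = 0
  · simp [ha]
  have h1 : (-1 : F) ≠ 0 := neg_ne_zero.mpr one_ne_zero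
  have h : cls (-1 : F) = 0 := by
    have h2 := cls_mul h1 h1
    rw [neg_mul_neg, mul_one, cls_one, ← two_smul ℚ] at h2
    exact (smul_eq_zero.mp h2.symm).resolve_left two_ne_zero
  rw [← neg_one_mul, cls_mul h1 ha, h, zero_add]

theorem vmap_cls (φ : F ≃+* F) (a : F) : vmap φ (cls a) = cls (φ a) := by
  by_cases ha : a = 0
  · simp [ha, cls]
  have hb : φ a ≠ 0 := by simpa using ha
  rw [cls_of_ne_zero ha, cls_of_ne_zero hb, vmap,
    TensorProduct.AlgebraTensorModule.map_tmul]
  congr 1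
  apply Additive.toMul.injective
  ext
  rfl

theorem vmap_trans (φ ψ : F ≃+* F) : vmap (φ.trans ψ) = vmap ψ ∘ₗ vmap φ := by
  apply TensorProduct.AlgebraTensorModule.ext
  intro q a
  rw [LinearMap.comp_apply]
  unfold vmap
  simp only [TensorProduct.AlgebraTensorModule.map_tmul]
  rfl

theorem tpMap_trans {n : ℕ} (φ ψ : F ≃+* F) (x : TP F n) :
    tpMap (φ.trans ψ) x = tpMap ψ (tpMap φ x) := by
  unfold tpMap
  rw [vmap_trans, PiTensorProduct.map_comp]
  rfl

theorem snoc_tprod {n : ℕ} (f : Fin n → VF F) (v : VF F) :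
    snoc (tprod ℚ f) v = tprod ℚ (Fin.snoc f v : Fin (n + 1) → VF F) := by
  simp [snoc]

theorem tpMap_snoc {n : ℕ} (φ : F ≃+* F) (x : TP F n) (v : VF F) :
    tpMap φ (snoc x v) = snoc (tpMap φ x) (vmap φ v) := by
  induction x using PiTensorProduct.induction_on with
  | smul_tprod c f =>
    simp only [map_smul, LinearMap.smul_apply, snoc_tprod, tpMap, PiTensorProduct.map_tprod]
    congr 2
    ext i
    refine Fin.lastCases ?_ (fun j => ?_) i <;> simp
  | add x y hx hy => simp only [map_add, LinearMap.add_apply, hx, hy]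

theorem vmap_tCoef (φ : F ≃+* F) (p a q : F) :
    vmap φ (tCoef p a q) = tCoef (φ p) (φ a) (φ q) := by
  unfold tCoef
  simp only [EmbeddingLike.apply_eq_iff_eq]
  split_ifs <;> simp [vmap_cls]

theorem tpMap_SIaux (φ : F ≃+* F) : ∀ (n : ℕ) (a : F) (as : List F) (b : F) (h : as.length = n)
    (h' : (as.map φ).length = n),
    tpMap φ (SIaux n a as b h) = SIaux n (φ a) (as.map φ) (φ b) h'
  | 0, a, as, b, h, h' => by
    simp only [SIaux, tpMap, PiTensorProduct.map_tprod]
    congr 1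
    ext i
    exact i.elim0
  | n + 1, a, as, b, h, h' => by
    simp only [SIaux, map_sum]
    refine Finset.sum_congr rfl fun i _ => ?_
    have e (l : List F) (j : ℕ) : φ (l.getD j 0) = (l.map φ).getD j 0 := by
      have := List.getD_map (l := l) (d := 0) (n := j) φ
      rw [← this, map_zero]
    rw [tpMap_snoc, tpMap_SIaux φ n _ _ _ _ (by simp [List.length_eraseIdx, h, i.is_le]),
      vmap_tCoef]
    simp only [e, List.map_cons, List.map_append, List.map_nil, List.eraseIdx_map]

end Symbols

section Alternation

variable {N m : ℕ}

theorem permAut_gen (σ : Equiv.Perm (Fin N)) (i : Fin N) (j : Fin m) :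
    permAut N m σ (gen N m i j) = gen N m (σ i) j := by
  simp [permAut, gen]

theorem permAut_mul (σ τ : Equiv.Perm (Fin N)) :
    permAut N m (σ * τ) = (permAut N m τ).trans (permAut N m σ) := by
  have h : ((permAut N m (σ * τ) : FF N m →+* FF N m)) =
      ((permAut N m τ).trans (permAut N m σ) : FF N m →+* FF N m) := by
    apply IsLocalization.ringHom_ext (nonZeroDivisors (Pol N m))
    apply MvPolynomial.ringHom_ext
    · intro q
      simp [permAut]
    · rintro ⟨i, j⟩
      simpa [gen] using (permAut_gen (m := m) (σ * τ) i j).trans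
        ((congrArg (permAut N m σ) (permAut_gen τ i j)).trans (permAut_gen σ (τ i) j)).symm
  exact RingEquiv.ext fun x => DFunLike.congr_fun h x

theorem permAut_dets (σ : Equiv.Perm (Fin N)) (c : Fin m → Fin N) :
    permAut N m σ (dets N m c) = dets N m (σ ∘ c) := by
  unfold dets
  rw [RingEquiv.map_det]
  congr 1
  ext i j
  simp [permAut_gen]

theorem dets_comp_perm (c : Fin m → Fin N) (e : Equiv.Perm (Fin m)) :
    dets N m (c ∘ e) = (Equiv.Perm.sign e : ℤ) * dets N m c :=
  Matrix.det_permute' e (Matrix.of fun r t => gen N m (c t) r)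

theorem dets_ne_zero {c : Fin m → Fin N} (hc : Function.Injective c) : dets N m c ≠ 0 := by
  let M : Matrix (Fin m) (Fin m) (MvPolynomial (Fin m × Fin m) ℚ) :=
    Matrix.mvPolynomialX (Fin m) (Fin m) ℚ
  let f : MvPolynomial (Fin m × Fin m) ℚ →+* FF N m :=
    (algebraMap (Pol N m) (FF N m)).comp
      (MvPolynomial.rename (fun p : Fin m × Fin m => (c p.2, p.1))).toRingHom
  have hf : Function.Injective f := by
    refine (IsFractionRing.injective (Pol N m) (FF N m)).comp
      (MvPolynomial.rename_injective _ ?_)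
    rintro ⟨a, b⟩ ⟨a', b'⟩ h
    simp only [Prod.mk.injEq] at h
    rw [hc h.1, h.2]
  have h : dets N m c = f M.det := by
    rw [RingHom.map_det]
    unfold dets
    congr 1
    ext i j
    simp [M, f, gen, Matrix.mvPolynomialX]
  rw [h, map_ne_zero_iff f hf]
  exact Matrix.det_mvPolynomialX_ne_zero (Fin m) ℚ

/-- Skew-symmetrization kills tensors fixed by a transposition. -/
theorem Alt_eq_zero_of_swap {n : ℕ} {u v : Fin N} (huv : u ≠ v) {x : TP (FF N m) n}
    (hx : tpMap (permAut N m (Equiv.swap u v)) x = x) : Alt x = 0 := by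
  have h : Alt x = -Alt x := by
    conv_lhs => unfold Alt
    rw [← Equiv.sum_comp (Equiv.mulRight (Equiv.swap u v))]
    simp only [Equiv.coe_mulRight, permAut_mul, tpMap_trans, hx, Equiv.Perm.sign_mul,
      Equiv.Perm.sign_swap huv]
    simp [Alt]
  have h2 : (2 : ℚ) • Alt x = 0 := by
    rw [two_smul]
    nth_rewrite 1 [h]
    exact neg_add_cancel _
  exact (smul_eq_zero.mp h2).resolve_left two_ne_zero

theorem Alt_add {n : ℕ} (x y : TP (FF N m) n) : Alt (x + y) = Alt x + Alt y := by
  simp [Alt, Finset.sum_add_distrib]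

end Alternation

section Pluecker

open scoped Matrix

/-- The three-term Plücker relation, for determinants sharing all rows outside `p` and `q`. -/
theorem det_update_mul_det_update {ι R : Type*} [Fintype ι] [DecidableEq ι] [CommRing R]
    (w : ι → ι → R) {p q : ι} (hpq : p ≠ q) (f : (ι → R) → (ι → R) → R)
    (hf : ∀ a b, f a b = (Matrix.of (Function.update (Function.update w p a) q b)).det)
    (a b x y : ι → R) :
    f a b * f x y = f a y * f x b + f x a * f y b := by
  change ∀ a b, f a b =
    Matrix.det (Function.update (Function.update w p a) q b : Matrix ι ι R) at hf
  let A : Matrix ι ι R := Function.update (Function.update w p x) q y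
  let g : (ι → R) →ₗ[R] R :=
    (Matrix.detRowAlternating (R := R) (n := ι)).toMultilinearMap.toLinearMap
      (Function.update w q b) p
  have hg (v : ι → R) : g v = f v b := by
    rw [hf, Function.update_comm hpq]
    rfl
  have hA : A.det = f x y := (hf x y).symm
  have hcr : ∑ i, Aᵀ.cramer a i • A i = f x y • a := by
    have h := Matrix.mulVec_cramer Aᵀ a
    rw [Matrix.det_transpose, hA] at h
    rw [← h]
    ext j
    simp [Matrix.mulVec, dotProduct, Finset.sum_apply, mul_comm]
  have hgi (i : ι) (hp : i ≠ p) (hq : i ≠ q) : g (A i) = 0 := by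
    rw [hg, hf]
    refine Matrix.det_zero_of_row_eq hp ?_
    simp [A, hp, hq, hpq]
  have hp : Aᵀ.cramer a p = f a y := by
    rw [Matrix.cramer_transpose_apply, hf]
    congr 1
    change Function.update A p a = _
    simp only [A]
    rw [Function.update_comm hpq, Function.update_idem, Function.update_comm hpq.symm]
  have hq : Aᵀ.cramer a q = f x a := by
    rw [Matrix.cramer_transpose_apply, hf]
    congr 1
    change Function.update A q a = _
    simp only [A]
    rw [Function.update_idem]
  have h := congrArg g hcr
  rw [map_sum, map_smul, ← Finset.sum_subset (Finset.subset_univ {p, q}) ?_,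
    Finset.sum_pair hpq, map_smul, map_smul, hp, hq, hg, hg, hg] at h
  · have hAp : A p = x := by simp [A, hpq]
    have hAq : A q = y := by simp [A]
    rw [hAp, hAq, smul_eq_mul, smul_eq_mul, smul_eq_mul] at h
    rw [h, mul_comm]
  · intro i _ hi
    simp only [Finset.mem_insert, Finset.mem_singleton, not_or] at hi
    rw [map_smul, hgi i hi.1 hi.2, smul_zero]

end Pluecker

end GrassPoly

namespace GrassPoly

noncomputable section Determinants

variable {k : ℕ}

theorem fin2m_inj {a b : ℕ} (ha : a < 2 * k + 4) (hb : b < 2 * k + 4) :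
    fin2m k a = fin2m k b ↔ a = b := by
  simp [fin2m, Nat.mod_eq_of_lt ha, Nat.mod_eq_of_lt hb]

variable (k) in
/-- `gdet` with columns labelled by natural numbers. -/
def ndet (c : Fin (k + 2) → ℕ) : FF (2 * k + 4) (k + 2) := gdet k (fun t => fin2m k (c t))

theorem fin2m_comp_injective {c : Fin (k + 2) → ℕ} (hc : Function.Injective c)
    (hlt : ∀ t, c t < 2 * k + 4) : Function.Injective fun t => fin2m k (c t) :=
  fun _ _ h => hc ((fin2m_inj (hlt _) (hlt _)).mp h)

theorem ndet_ne_zero {c : Fin (k + 2) → ℕ} (hc : Function.Injective c)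
    (hlt : ∀ t, c t < 2 * k + 4) : ndet k c ≠ 0 :=
  dets_ne_zero (fin2m_comp_injective hc hlt)

theorem ndet_comp_perm (c : Fin (k + 2) → ℕ) (e : Equiv.Perm (Fin (k + 2))) :
    ndet k (c ∘ e) = (Equiv.Perm.sign e : ℤ) * ndet k c :=
  dets_comp_perm (fun t => fin2m k (c t)) e

variable (k) in
/-- The automorphism exchanging the vectors labelled `u` and `v`. -/
def swapAut (u v : ℕ) : FF (2 * k + 4) (k + 2) ≃+* FF (2 * k + 4) (k + 2) :=
  permAut (2 * k + 4) (k + 2) (Equiv.swap (fin2m k u) (fin2m k v))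

theorem swapAut_ndet_of_mem {c : Fin (k + 2) → ℕ} (hc : Function.Injective c)
    (hlt : ∀ t, c t < 2 * k + 4) {p q : Fin (k + 2)} (hpq : p ≠ q) :
    swapAut k (c p) (c q) (ndet k c) = -ndet k c := by
  have h : (Equiv.swap (fin2m k (c p)) (fin2m k (c q))) ∘ (fun t => fin2m k (c t)) =
      (fun t => fin2m k (c t)) ∘ Equiv.swap p q :=
    Function.Injective.swap_comp (fin2m_comp_injective hc hlt) p q
  unfold swapAut ndet gdet
  rw [permAut_dets, h, dets_comp_perm, Equiv.Perm.sign_swap hpq]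
  simp

theorem swapAut_ndet_of_notMem {c : Fin (k + 2) → ℕ} (hlt : ∀ t, c t < 2 * k + 4) {u v : ℕ}
    (hu : u < 2 * k + 4) (hv : v < 2 * k + 4) (hcu : ∀ t, c t ≠ u) (hcv : ∀ t, c t ≠ v) :
    swapAut k u v (ndet k c) = ndet k c := by
  unfold swapAut ndet gdet
  rw [permAut_dets]
  congr 1
  ext1 t
  exact Equiv.swap_apply_of_ne_of_ne (fun h => hcu t ((fin2m_inj (hlt t) hu).mp h))
    (fun h => hcv t ((fin2m_inj (hlt t) hv).mp h))

theorem vmap_swapAut_ndet_of_mem {c : Fin (k + 2) → ℕ} (hc : Function.Injective c)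
    (hlt : ∀ t, c t < 2 * k + 4) {u v : ℕ} (p q : Fin (k + 2)) (huv : u ≠ v) (hp : c p = u)
    (hq : c q = v) : vmap (swapAut k u v) (cls (ndet k c)) = cls (ndet k c) := by
  subst hp hq
  rw [vmap_cls, swapAut_ndet_of_mem hc hlt (fun h => huv (congrArg c h)), cls_neg]

theorem vmap_swapAut_ndet_of_notMem {c : Fin (k + 2) → ℕ} (hlt : ∀ t, c t < 2 * k + 4) {u v : ℕ}
    (hu : u < 2 * k + 4) (hv : v < 2 * k + 4) (hcu : ∀ t, c t ≠ u) (hcv : ∀ t, c t ≠ v) :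
    vmap (swapAut k u v) (cls (ndet k c)) = cls (ndet k c) := by
  rw [vmap_cls, swapAut_ndet_of_notMem hlt hu hv hcu hcv]

/-- The labels `s, s + 1, …, s + k, b`. -/
def runCols (k s b : ℕ) (t : Fin (k + 2)) : ℕ := if t.val < k + 1 then s + t.val else b

/-- The labels `s + 1, …, s + k, a, b`. -/
def pairCols (k s a b : ℕ) (t : Fin (k + 2)) : ℕ :=
  if t.val < k then s + 1 + t.val else if t.val = k then a else b

theorem grho_succ (s : ℕ) :
    grho k (s + 1) =
      ndet k (runCols k s (2 * k + 2)) / ndet k (runCols k s (2 * k + 3)) := by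
  simp only [grho, ndet, runCols, Nat.add_sub_cancel, apply_ite (fin2m k)]

theorem runCols_injective {s b : ℕ} (h : s + k < b) : Function.Injective (runCols k s b) := by
  intro t t' ht
  simp only [runCols] at ht
  ext
  split_ifs at ht <;> omega

theorem runCols_lt {s b : ℕ} (hs : s + k < 2 * k + 4) (hb : b < 2 * k + 4) (t : Fin (k + 2)) :
    runCols k s b t < 2 * k + 4 := by
  unfold runCols
  split_ifs <;> omega

theorem pairCols_injective {s a b : ℕ} (ha : a ≤ s ∨ s + k < a) (hb : b ≤ s ∨ s + k < b)
    (hab : a ≠ b) : Function.Injective (pairCols k s a b) := by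
  intro t t' ht
  simp only [pairCols] at ht
  ext
  split_ifs at ht <;> omega

theorem pairCols_lt {s a b : ℕ} (hs : s + k < 2 * k + 4) (ha : a < 2 * k + 4)
    (hb : b < 2 * k + 4) (t : Fin (k + 2)) : pairCols k s a b t < 2 * k + 4 := by
  unfold pairCols
  split_ifs <;> omega

theorem runCols_succ (s b : ℕ) : runCols k (s + 1) b = pairCols k s (s + k + 1) b := by
  ext t
  simp only [runCols, pairCols]
  split_ifs <;> omega

theorem pairCols_self (s b : ℕ) :
    pairCols k s s b = runCols k s b ∘ Fin.cycleRange (⟨k, by omega⟩ : Fin (k + 2)) := by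
  ext t
  simp only [Function.comp_apply]
  rcases lt_trichotomy t.val k with h | h | h
  · have := Fin.coe_cycleRange_of_lt (i := t) (j := ⟨k, by omega⟩) (by simpa [Fin.lt_def] using h)
    simp only [runCols, pairCols, this]
    split_ifs <;> omega
  · rw [Fin.cycleRange_of_eq (Fin.ext h)]
    simp [runCols, pairCols, h]
  · rw [Fin.cycleRange_of_gt (by simpa [Fin.lt_def] using h)]
    simp only [runCols, pairCols]
    split_ifs <;> omega

theorem exists_ndet_pairCols_self (k s : ℕ) :
    ∃ ε : ℤˣ, ∀ b, ndet k (pairCols k s s b) = (ε : ℤ) * ndet k (runCols k s b) :=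
  ⟨_, fun b => by rw [pairCols_self, ndet_comp_perm]⟩

theorem ndet_pairCols_comm (s a b : ℕ) :
    ndet k (pairCols k s a b) = -ndet k (pairCols k s b a) := by
  have hne : (⟨k, by omega⟩ : Fin (k + 2)) ≠ ⟨k + 1, by omega⟩ := by simp
  have h : pairCols k s a b =
      pairCols k s b a ∘ Equiv.swap (⟨k, by omega⟩ : Fin (k + 2)) ⟨k + 1, by omega⟩ := by
    ext t
    rcases lt_trichotomy t.val k with h | h | h
    · rw [Function.comp_apply, Equiv.swap_apply_of_ne_of_ne] <;>
        simp [pairCols, Fin.ext_iff, h] <;> omega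
    · have ht : t = ⟨k, by omega⟩ := Fin.ext h
      rw [ht]
      simp [pairCols]
    · have ht : t = ⟨k + 1, by omega⟩ := Fin.ext (by simp only; omega)
      rw [ht]
      simp [pairCols]
  rw [h, ndet_comp_perm, Equiv.Perm.sign_swap hne]
  simp

theorem ndet_pairCols_mul (s a b x y : ℕ) :
    ndet k (pairCols k s a b) * ndet k (pairCols k s x y) =
      ndet k (pairCols k s a y) * ndet k (pairCols k s x b) +
        ndet k (pairCols k s x a) * ndet k (pairCols k s y b) := by
  let g (n : ℕ) : Fin (k + 2) → FF (2 * k + 4) (k + 2) := gen _ _ (fin2m k n)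
  let w (t : Fin (k + 2)) : Fin (k + 2) → FF (2 * k + 4) (k + 2) := g (s + 1 + t)
  have hne : (⟨k, by omega⟩ : Fin (k + 2)) ≠ ⟨k + 1, by omega⟩ := by simp
  have key (a b : ℕ) : ndet k (pairCols k s a b) = (Matrix.of (Function.update
      (Function.update w ⟨k, by omega⟩ (g a)) ⟨k + 1, by omega⟩ (g b))).det := by
    rw [← Matrix.det_transpose]
    unfold ndet gdet dets
    congr 1
    ext r t
    simp only [Matrix.of_apply, Matrix.transpose_apply, Function.update_apply, Fin.ext_iff,
      pairCols]
    have := t.isLt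
    split_ifs <;> first | rfl | omega
  simp only [key]
  exact det_update_mul_det_update w hne _ (fun _ _ => rfl) (g a) (g b) (g x) (g y)

theorem grho_sub_grho {s : ℕ} (hs : s ≤ k) :
    ∃ ε : ℤˣ, grho k (s + 2) - grho k (s + 1) =
      (ε : ℤ) * (ndet k (pairCols k s s (s + k + 1)) *
          ndet k (pairCols k s (2 * k + 2) (2 * k + 3)) /
        (ndet k (runCols k s (2 * k + 3)) * ndet k (runCols k (s + 1) (2 * k + 3)))) := by
  obtain ⟨ε, hε⟩ := exists_ndet_pairCols_self k s
  have h1 : ndet k (runCols k s (2 * k + 3)) ≠ 0 :=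
    ndet_ne_zero (runCols_injective (by omega)) (runCols_lt (by omega) (by omega))
  have h2 : ndet k (runCols k (s + 1) (2 * k + 3)) ≠ 0 :=
    ndet_ne_zero (runCols_injective (by omega)) (runCols_lt (by omega) (by omega))
  have hP := ndet_pairCols_mul (k := k) s s (s + k + 1) (2 * k + 2) (2 * k + 3)
  rw [ndet_pairCols_comm s (2 * k + 2) (s + k + 1), ndet_pairCols_comm s (2 * k + 2) s,
    ndet_pairCols_comm s (2 * k + 3) (s + k + 1), hε (2 * k + 2), hε (2 * k + 3),
    ← runCols_succ, ← runCols_succ] at hP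
  refine ⟨-ε, ?_⟩
  rw [show s + 2 = s + 1 + 1 from rfl, grho_succ (s + 1), grho_succ s, hP]
  have hsq : ((ε : ℤ) : FF (2 * k + 4) (k + 2)) * (ε : ℤ) = 1 := by
    rw [← Int.cast_mul, ← Units.val_mul, Int.units_mul_self]; simp
  rw [div_sub_div _ _ h2 h1, mul_comm (ndet k (runCols k s (2 * k + 3))), mul_div_assoc',
    Units.val_neg, Int.cast_neg]
  congr 1
  linear_combination (- ndet k (runCols k (s + 1) (2 * k + 2)) * ndet k (runCols k s (2 * k + 3))
    + ndet k (runCols k (s + 1) (2 * k + 3)) * ndet k (runCols k s (2 * k + 2))) * hsq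

theorem ndet_runCols_ne_zero {s b : ℕ} (hs : s ≤ k + 1) (hb : 2 * k + 2 ≤ b)
    (hb' : b < 2 * k + 4) : ndet k (runCols k s b) ≠ 0 :=
  ndet_ne_zero (runCols_injective (by omega)) (runCols_lt (by omega) hb')

theorem grho_ne_zero {j : ℕ} (h1 : 1 ≤ j) (h2 : j ≤ k + 2) : grho k j ≠ 0 := by
  obtain ⟨s, rfl⟩ := Nat.exists_eq_add_of_le' h1
  rw [grho_succ]
  exact div_ne_zero (ndet_runCols_ne_zero (by omega) (by omega) (by omega))
    (ndet_runCols_ne_zero (by omega) (by omega) (by omega))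

theorem cls_units_mul {F : Type} [Field F] (ε : ℤˣ) (a : F) : cls (((ε : ℤ) : F) * a) = cls a := by
  rcases Int.units_eq_one_or ε with rfl | rfl <;> simp [cls_neg]

theorem ndet_pairCols_run_ne_zero {s : ℕ} (hs : s ≤ k) :
    ndet k (pairCols k s s (s + k + 1)) ≠ 0 :=
  ndet_ne_zero (pairCols_injective (by omega) (by omega) (by omega))
    (pairCols_lt (by omega) (by omega) (by omega))

theorem ndet_pairCols_last_ne_zero {s : ℕ} (hs : s ≤ k) :
    ndet k (pairCols k s (2 * k + 2) (2 * k + 3)) ≠ 0 :=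
  ndet_ne_zero (pairCols_injective (by omega) (by omega) (by omega))
    (pairCols_lt (by omega) (by omega) (by omega))

theorem grho_succ_ne {s : ℕ} (hs : s ≤ k) : grho k (s + 1) ≠ grho k (s + 2) := by
  obtain ⟨ε, h⟩ := grho_sub_grho hs
  refine (sub_ne_zero.mp ?_).symm
  rw [h]
  refine mul_ne_zero ?_ (div_ne_zero (mul_ne_zero (ndet_pairCols_run_ne_zero hs)
    (ndet_pairCols_last_ne_zero hs)) (mul_ne_zero
      (ndet_runCols_ne_zero (by omega) (by omega) (by omega))
      (ndet_runCols_ne_zero (by omega) (by omega) (by omega))))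
  rcases Int.units_eq_one_or ε with rfl | rfl <;> simp

theorem cls_grho_sub_grho {s : ℕ} (hs : s ≤ k) :
    cls (grho k (s + 2) - grho k (s + 1)) =
      cls (ndet k (pairCols k s s (s + k + 1))) +
          cls (ndet k (pairCols k s (2 * k + 2) (2 * k + 3))) -
        (cls (ndet k (runCols k s (2 * k + 3))) +
          cls (ndet k (runCols k (s + 1) (2 * k + 3)))) := by
  obtain ⟨ε, h⟩ := grho_sub_grho hs
  have h1 := ndet_pairCols_run_ne_zero hs
  have h2 := ndet_pairCols_last_ne_zero hs
  have h3 : ndet k (runCols k s (2 * k + 3)) ≠ 0 :=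
    ndet_runCols_ne_zero (by omega) (by omega) (by omega)
  have h4 : ndet k (runCols k (s + 1) (2 * k + 3)) ≠ 0 :=
    ndet_runCols_ne_zero (by omega) (by omega) (by omega)
  rw [h, cls_units_mul, cls_div (mul_ne_zero h1 h2) (mul_ne_zero h3 h4), cls_mul h1 h2,
    cls_mul h3 h4]

/-- A transposition of two labels `u, v < 2m - 2` fixes `ρ_j` if it involves both or none of the
consecutive labels of `ρ_j`. -/
theorem swapAut_grho {j u v : ℕ} (h1 : 1 ≤ j) (h2 : j ≤ k + 2) (hu : u < 2 * k + 2)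
    (hv : v < 2 * k + 2) (huv : u ≠ v)
    (h : (j ≤ u + 1 ∧ u < j + k ∧ j ≤ v + 1 ∧ v < j + k) ∨
      ((u + 1 < j ∨ j + k ≤ u) ∧ (v + 1 < j ∨ j + k ≤ v))) :
    swapAut k u v (grho k j) = grho k j := by
  obtain ⟨s, rfl⟩ := Nat.exists_eq_add_of_le' h1
  rw [grho_succ, map_div₀]
  rcases h with h | h
  · have key (b : ℕ) (hb : 2 * k + 2 ≤ b) (hb' : b < 2 * k + 4) :
        swapAut k u v (ndet k (runCols k s b)) = -ndet k (runCols k s b) := by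
      have := swapAut_ndet_of_mem (runCols_injective (k := k) (s := s) (b := b) (by omega))
        (runCols_lt (by omega) hb')
        (p := ⟨u - s, by omega⟩) (q := ⟨v - s, by omega⟩) (by simp; omega)
      have e1 : runCols k s b ⟨u - s, by omega⟩ = u := by
        simp only [runCols]; split_ifs <;> omega
      have e2 : runCols k s b ⟨v - s, by omega⟩ = v := by
        simp only [runCols]; split_ifs <;> omega
      rwa [e1, e2] at this
    rw [key _ (by omega) (by omega), key _ (by omega) (by omega), neg_div_neg_eq]
  · have key (b : ℕ) (hb : 2 * k + 2 ≤ b) (hb' : b < 2 * k + 4) :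
        swapAut k u v (ndet k (runCols k s b)) = ndet k (runCols k s b) := by
      refine swapAut_ndet_of_notMem (runCols_lt (by omega) hb') (by omega) (by omega) ?_ ?_ <;>
      · intro t
        simp only [runCols]
        split_ifs <;> omega
    rw [key _ (by omega) (by omega), key _ (by omega) (by omega)]

theorem exists_tCoef_grho_eq_add {s : ℕ} (hs : s < k) :
    ∃ t₁ t₂, tCoef (grho k (s + 1)) (grho k (s + 2)) (grho k (s + 3)) = t₁ + t₂ ∧
      vmap (swapAut k s (s + 1)) t₁ = t₁ ∧
      vmap (swapAut k (s + k + 1) (s + k + 2)) t₂ = t₂ := by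
  have e1 := grho_succ_ne hs.le
  have e2 := grho_succ_ne (show s + 1 ≤ k from hs)
  refine ⟨cls (ndet k (pairCols k (s + 1) (2 * k + 2) (2 * k + 3))) -
      cls (ndet k (runCols k (s + 2) (2 * k + 3))) - cls (ndet k (pairCols k s s (s + k + 1))) +
      cls (ndet k (runCols k s (2 * k + 3))),
    cls (ndet k (pairCols k (s + 1) (s + 1) (s + 1 + k + 1))) -
      cls (ndet k (pairCols k s (2 * k + 2) (2 * k + 3))), ?_, ?_, ?_⟩
  · rw [tCoef, if_neg e1, if_neg e2, cls_div (sub_ne_zero.mpr e2.symm) (sub_ne_zero.mpr e1),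
      ← cls_neg (grho k (s + 1) - _), neg_sub, cls_grho_sub_grho hs.le,
      cls_grho_sub_grho (show s + 1 ≤ k from hs)]
    abel
  · simp only [map_add, map_sub]
    congr 1
    · congr 1
      · congr 1
        · apply vmap_swapAut_ndet_of_notMem (pairCols_lt (by omega) (by omega) (by omega))
            (by omega) (by omega) <;>
          · intro t
            simp only [pairCols]
            split_ifs <;> omega
        · apply vmap_swapAut_ndet_of_notMem (runCols_lt (by omega) (by omega))
            (by omega) (by omega) <;>
          · intro t
            simp only [runCols]
            split_ifs <;> omega
      · refine vmap_swapAut_ndet_of_mem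
          (pairCols_injective (by omega) (by omega) (by omega))
          (pairCols_lt (by omega) (by omega) (by omega)) ⟨k, by omega⟩ ⟨0, by omega⟩ (by omega)
            ?_ ?_ <;>
        · simp only [pairCols]
          split_ifs <;> omega
    · refine vmap_swapAut_ndet_of_mem (runCols_injective (by omega))
          (runCols_lt (by omega) (by omega)) ⟨0, by omega⟩ ⟨1, by omega⟩ (by omega) ?_ ?_ <;>
      · simp only [runCols]
        split_ifs <;> omega
  · simp only [map_sub]
    congr 1
    · refine vmap_swapAut_ndet_of_mem
        (pairCols_injective (by omega) (by omega) (by omega))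
        (pairCols_lt (by omega) (by omega) (by omega)) ⟨k - 1, by omega⟩ ⟨k + 1, by omega⟩
          (by omega) ?_ ?_ <;>
      · simp only [pairCols]
        split_ifs <;> omega
    · apply vmap_swapAut_ndet_of_notMem (pairCols_lt (by omega) (by omega) (by omega))
        (by omega) (by omega) <;>
      · intro t
        simp only [pairCols]
        split_ifs <;> omega

end Determinants

end GrassPoly

namespace GrassPoly

noncomputable section Expansion

section Runs

variable {F : Type} (r : ℕ → F)

/-- The consecutive entries `r s, r (s + 1), …, r (s + n - 1)`. -/
def run (s n : ℕ) : List F := (List.range' s n).map r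

theorem length_run (s n : ℕ) : (run r s n).length = n := by simp [run]

theorem run_succ (s n : ℕ) : run r s (n + 1) = r s :: run r (s + 1) n := by
  simp [run, List.range'_succ]

theorem run_append (s n : ℕ) : run r s n ++ [r (s + n)] = run r s (n + 1) := by
  simp [run, List.range'_1_concat]

theorem exists_of_mem_eraseIdx_run {s n i : ℕ} {a : F} (h : a ∈ (run r s n).eraseIdx i) :
    ∃ j, s ≤ j ∧ j < s + n ∧ j ≠ s + i ∧ a = r j := by
  rw [List.mem_eraseIdx_iff_getElem] at h
  obtain ⟨j, hj, hji, rfl⟩ := h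
  rw [length_run] at hj
  exact ⟨s + j, by omega, by omega, by omega, by simp [run]⟩

theorem length_eraseIdx_run (s n i : ℕ) (hi : i < n + 1) :
    ((run r s (n + 1)).eraseIdx i).length = n := by
  rw [List.length_eraseIdx_of_lt (by rwa [length_run]), length_run, Nat.add_sub_cancel]

end Runs

section Recursion

variable {F : Type} [Field F] (r : ℕ → F)

theorem getD_run {s n i : ℕ} (hi : i < n) : (run r s n).getD i 0 = r (s + i) := by
  rw [List.getD_eq_getElem _ _ (by simpa [run] using hi)]
  simp [run]

theorem SIaux_congr {n : ℕ} (a : F) {as as' : List F} (b : F) (h : as = as') (h₁ : as.length = n)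
    (h₂ : as'.length = n) : SIaux n a as b h₁ = SIaux n a as' b h₂ := by
  subst h
  rfl

theorem tCoef_zero_left {a q : F} (ha : a ≠ 0) (haq : a ≠ q) :
    tCoef 0 a q = cls (1 - q / a) := by
  rw [tCoef, if_neg ha.symm, if_neg haq]
  congr 1
  field_simp
  ring

theorem tCoef_zero_zero {q : F} (hq : q ≠ 0) : tCoef 0 0 q = cls q := by
  rw [tCoef, if_pos rfl, if_neg hq.symm, sub_zero]

/-- The recursion for `S I(0; r_s, …, r_{s+n}; r_{s+n+1})`. -/
theorem SIaux_run_succ (s n : ℕ) :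
    SIaux (n + 1) 0 (run r s (n + 1)) (r (s + n + 1)) (length_run r s (n + 1)) =
      snoc (SIaux n 0 (run r (s + 1) n) (r (s + n + 1)) (length_run r (s + 1) n))
          (tCoef 0 (r s) (r (s + 1))) +
        ∑ i : Fin n, snoc (SIaux n 0 ((run r s (n + 1)).eraseIdx (i + 1)) (r (s + n + 1))
            (length_eraseIdx_run r s n _ (by omega)))
          (tCoef (r (s + i)) (r (s + i + 1)) (r (s + i + 2))) := by
  rw [SIaux, Fin.sum_univ_succ]
  congr 1
  · congr 1
    · have e : run r s (n + 1) ++ [r (s + n + 1)] = run r s (n + 2) := run_append r s (n + 1)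
      rw [e]
      simp [run_succ]
  · refine Finset.sum_congr rfl fun i _ => ?_
    congr 1
    have e : run r s (n + 1) ++ [r (s + n + 1)] = run r s (n + 2) := run_append r s (n + 1)
    rw [e, Fin.val_succ, List.getD_cons_succ, getD_run r (by omega), getD_run r (by omega),
      getD_run r (by omega)]
    rfl

/-- The recursion for `S I(0; 0, r_s, …, r_{s+n}; r_{s+n+1})`. -/
theorem SIaux_zero_run_succ (s n : ℕ) :
    SIaux (n + 2) 0 (0 :: run r s (n + 1)) (r (s + n + 1)) (by simp [length_run]) =
      snoc (SIaux (n + 1) 0 (run r s (n + 1)) (r (s + n + 1)) (length_run r s (n + 1)))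
          (tCoef 0 0 (r s)) +
        (snoc (SIaux (n + 1) 0 (0 :: run r (s + 1) n) (r (s + n + 1)) (by simp [length_run]))
          (tCoef 0 (r s) (r (s + 1))) +
        ∑ i : Fin n, snoc (SIaux (n + 1) 0 (0 :: (run r s (n + 1)).eraseIdx (i + 1))
            (r (s + n + 1)) (by
              rw [List.length_cons, length_eraseIdx_run r s n _ (by omega)]))
          (tCoef (r (s + i)) (r (s + i + 1)) (r (s + i + 2)))) := by
  have e : run r s (n + 1) ++ [r (s + n + 1)] = run r s (n + 2) := run_append r s (n + 1)
  rw [SIaux, Fin.sum_univ_succ, Fin.sum_univ_succ]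
  refine congrArg₂ _ ?_ (congrArg₂ _ ?_ (Finset.sum_congr rfl fun i _ => ?_))
  · rfl
  · congr 1
    rw [List.cons_append, e]
    simp [run_succ]
  · congr 1
    rw [List.cons_append, e, Fin.val_succ, Fin.val_succ, List.getD_cons_succ, List.getD_cons_succ,
      List.getD_cons_succ, List.getD_cons_succ, getD_run r (by omega), getD_run r (by omega),
      getD_run r (by omega)]
    rfl

/-- `[1 - r_{s+n}/r_{s+n-1}] ⊗ ⋯ ⊗ [1 - r_{s+1}/r_s]`. -/
def quotTensor : (n s : ℕ) → TP F n
  | 0, _ => tprod ℚ (fun i : Fin 0 => i.elim0)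
  | n + 1, s => snoc (quotTensor n (s + 1)) (cls (1 - r (s + 1) / r s))

/-- The sum of the tensors obtained from `quotTensor r n s` by inserting `[r_{s+j}]` as the
`(j + 1)`-st slot from the right, for `0 ≤ j ≤ n`. -/
def insertTensor : (n s : ℕ) → TP F (n + 1)
  | 0, s => snoc (quotTensor r 0 s) (cls (r s))
  | n + 1, s => snoc (quotTensor r (n + 1) s) (cls (r s)) +
      snoc (insertTensor n (s + 1)) (cls (1 - r (s + 1) / r s))

theorem quotTensor_eq_tprod : ∀ n s : ℕ, quotTensor r n s =
    tprod ℚ (fun p : Fin n => cls (1 - r (s + n - p) / r (s + n - (p + 1))))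
  | 0, s => by
    rw [quotTensor]
    congr 1
    ext i
    exact i.elim0
  | n + 1, s => by
    rw [quotTensor, quotTensor_eq_tprod n (s + 1), snoc_tprod]
    congr 1
    ext1 p
    refine Fin.lastCases ?_ (fun p => ?_) p
    · rw [Fin.snoc_last, Fin.val_last]
      congr 4 <;> omega
    · rw [Fin.snoc_castSucc, Fin.val_castSucc]
      congr 4 <;> omega

theorem insertTensor_eq_sum : ∀ n s : ℕ, insertTensor r n s =
    ∑ j ∈ Finset.range (n + 1), tprod ℚ (fun p : Fin (n + 1) =>
      if p.val + j = n then cls (r (s + j))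
      else cls (1 - r (s + n + 1 - (if p.val + j < n then p.val + 1 else p.val)) /
        r (s + n - (if p.val + j < n then p.val + 1 else p.val))))
  | 0, s => by
    rw [insertTensor, quotTensor, snoc_tprod]
    simp only [zero_add, Finset.range_one, Finset.sum_singleton]
    congr 1
    ext1 p
    obtain rfl : p = Fin.last 0 := Fin.ext (by simp)
    rw [Fin.snoc_last]
    simp
  | n + 1, s => by
    rw [insertTensor, insertTensor_eq_sum n (s + 1), quotTensor_eq_tprod, snoc_tprod,
      Finset.sum_range_succ' _ (n + 1), map_sum, LinearMap.sum_apply]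
    refine (add_comm _ _).trans ?_
    congr 1
    · refine Finset.sum_congr rfl fun j hj => ?_
      rw [Finset.mem_range] at hj
      rw [snoc_tprod]
      congr 1
      ext1 p
      refine Fin.lastCases ?_ (fun p => ?_) p
      · rw [Fin.snoc_last, Fin.val_last, if_neg (by omega), if_neg (by omega)]
        congr 4 <;> omega
      · rw [Fin.snoc_castSucc, Fin.val_castSucc]
        have e : (p.val + j < n) = (p.val + (j + 1) < n + 1) := propext (by omega)
        have e' : (p.val + j = n) = (p.val + (j + 1) = n + 1) := propext (by omega)
        simp only [e, e']
        split_ifs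
        · congr 2; omega
        · congr 4 <;> omega
        · congr 4 <;> omega
    · congr 1
      ext1 p
      refine Fin.lastCases ?_ (fun p => ?_) p
      · rw [Fin.snoc_last, Fin.val_last]
        simp
      · rw [Fin.snoc_castSucc, Fin.val_castSucc, if_neg (by omega), if_pos (by omega)]
        congr 4
        omega

end Recursion

section Reduction

variable {k : ℕ}

theorem Alt_sum {N m n : ℕ} {ι : Type*} (t : Finset ι) (x : ι → TP (FF N m) n) :
    Alt (∑ i ∈ t, x i) = ∑ i ∈ t, Alt (x i) := by
  simp only [Alt, map_sum, Finset.smul_sum]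
  exact Finset.sum_comm

/-- The linear maps commuting with every permutation of the vectors that fixes
`ρ_1, …, ρ_s`. -/
def EquivariantUpTo (s : ℕ) {n l : ℕ}
    (Φ : TP (FF (2 * k + 4) (k + 2)) n →ₗ[ℚ] TP (FF (2 * k + 4) (k + 2)) l) : Prop :=
  ∀ u v : ℕ, (∀ j, 1 ≤ j → j ≤ s → swapAut k u v (grho k j) = grho k j) →
    ∀ x, tpMap (swapAut k u v) (Φ x) = Φ (tpMap (swapAut k u v) x)

theorem EquivariantUpTo.snoc_cls {s n l : ℕ}
    {Φ : TP (FF (2 * k + 4) (k + 2)) (n + 1) →ₗ[ℚ] TP (FF (2 * k + 4) (k + 2)) l}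
    (hΦ : EquivariantUpTo s Φ) {s' : ℕ} (hs : s ≤ s') {a : FF (2 * k + 4) (k + 2)}
    (ha : ∀ u v : ℕ, (∀ j, 1 ≤ j → j ≤ s' → swapAut k u v (grho k j) = grho k j) →
      swapAut k u v a = a) :
    EquivariantUpTo s' (Φ ∘ₗ (snoc (n := n)).flip (cls a)) := by
  intro u v h x
  rw [LinearMap.comp_apply, LinearMap.comp_apply, hΦ u v fun j h1 h2 => h j h1 (h2.trans hs),
    LinearMap.flip_apply, LinearMap.flip_apply, tpMap_snoc, vmap_cls, ha u v h]

theorem Alt_eq_zero_of_swapAut {n u v : ℕ} (hu : u < 2 * k + 4) (hv : v < 2 * k + 4)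
    (huv : u ≠ v) {x : TP (FF (2 * k + 4) (k + 2)) n} (hx : tpMap (swapAut k u v) x = x) :
    Alt x = 0 :=
  Alt_eq_zero_of_swap (fun h => huv ((fin2m_inj hu hv).mp h)) hx

/-- Deleting an interior argument `ρ_{i+2}` contributes nothing after skew-symmetrization. -/
theorem Alt_snoc_tCoef_eq_zero {s i n l : ℕ} (hs : s ≤ i + 1) (hi : i < k)
    {Φ : TP (FF (2 * k + 4) (k + 2)) (n + 1) →ₗ[ℚ] TP (FF (2 * k + 4) (k + 2)) l}
    (hΦ : EquivariantUpTo s Φ) {as : List (FF (2 * k + 4) (k + 2))} (hlen : as.length = n)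
    {b : FF (2 * k + 4) (k + 2)} (hb : b = grho k (k + 2))
    (has : ∀ a ∈ as, a = 0 ∨ ∃ j, 1 ≤ j ∧ j ≤ k + 2 ∧ j ≠ i + 2 ∧ a = grho k j) :
    Alt (Φ (snoc (SIaux n 0 as b hlen)
      (tCoef (grho k (i + 1)) (grho k (i + 2)) (grho k (i + 3))))) = 0 := by
  subst hb
  obtain ⟨t₁, t₂, ht, h₁, h₂⟩ := exists_tCoef_grho_eq_add hi
  have key (u v : ℕ) (hu : u < 2 * k + 4) (hv : v < 2 * k + 4) (huv : u ≠ v)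
      (hfix : ∀ j, 1 ≤ j → j ≤ k + 2 → j ≠ i + 2 → swapAut k u v (grho k j) = grho k j)
      (t : VF (FF (2 * k + 4) (k + 2))) (htt : vmap (swapAut k u v) t = t) :
      Alt (Φ (snoc (SIaux n 0 as (grho k (k + 2)) hlen) t)) = 0 := by
    apply Alt_eq_zero_of_swapAut hu hv huv
    rw [hΦ u v fun j h1 h2 => hfix j h1 (by omega) (by omega), tpMap_snoc, htt,
      tpMap_SIaux _ _ _ _ _ _ (by rw [List.length_map, hlen]), map_zero,
      hfix (k + 2) (by omega) le_rfl (by omega)]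
    congr 3
    apply SIaux_congr
    refine (List.map_congr_left fun a ha => ?_).trans (List.map_id as)
    rcases has a ha with rfl | ⟨j, h1, h2, h3, rfl⟩
    · exact map_zero _
    · exact hfix j h1 h2 h3
  rw [ht, map_add, map_add, Alt_add,
    key i (i + 1) (by omega) (by omega) (by omega) (fun j hj1 hj2 hj3 => swapAut_grho hj1 hj2
      (by omega) (by omega) (by omega) (by omega)) t₁ h₁,
    key (i + k + 1) (i + k + 2) (by omega) (by omega) (by omega) (fun j hj1 hj2 hj3 =>
      swapAut_grho hj1 hj2 (by omega) (by omega) (by omega) (by omega)) t₂ h₂, add_zero]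

theorem swapAut_one_sub_div {s u v : ℕ} (hs : 1 ≤ s)
    (h : ∀ j, 1 ≤ j → j ≤ s + 1 → swapAut k u v (grho k j) = grho k j) :
    swapAut k u v (1 - grho k (s + 1) / grho k s) = 1 - grho k (s + 1) / grho k s := by
  rw [map_sub, map_one, map_div₀, h s hs (by omega), h (s + 1) (by omega) le_rfl]

theorem tCoef_zero_grho {s : ℕ} (hs : 1 ≤ s) (hk : s ≤ k + 1) :
    tCoef 0 (grho k s) (grho k (s + 1)) = cls (1 - grho k (s + 1) / grho k s) := by
  obtain ⟨s, rfl⟩ := Nat.exists_eq_add_of_le' hs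
  exact tCoef_zero_left (grho_ne_zero hs (by omega)) (grho_succ_ne (by omega))

theorem Alt_SIaux_run : ∀ {n s l : ℕ} (_ : 1 ≤ s) (_ : s + n = k + 2)
    {Φ : TP (FF (2 * k + 4) (k + 2)) n →ₗ[ℚ] TP (FF (2 * k + 4) (k + 2)) l}
    (_ : EquivariantUpTo s Φ),
    Alt (Φ (SIaux n 0 (run (grho k) s n) (grho k (s + n)) (length_run _ s n))) =
      Alt (Φ (quotTensor (grho k) n s))
  | 0, _, _, _, _, _, _ => rfl
  | n + 1, s, l, hs, hk, Φ, hΦ => by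
    have ih := Alt_SIaux_run (n := n) (s := s + 1) (by omega) (by omega)
      (hΦ.snoc_cls s.le_succ fun _ _ => swapAut_one_sub_div hs)
    rw [LinearMap.comp_apply, LinearMap.comp_apply, LinearMap.flip_apply, LinearMap.flip_apply,
      Nat.add_right_comm s 1 n] at ih
    rw [← add_assoc s n 1, SIaux_run_succ, map_add, map_sum, Alt_add, Alt_sum, Finset.sum_eq_zero,
      add_zero,
      tCoef_zero_grho hs (by omega), ih, quotTensor]
    intro i _
    obtain ⟨t, ht⟩ := Nat.exists_eq_add_of_le' (show 1 ≤ s + i by omega)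
    rw [ht]
    refine Alt_snoc_tCoef_eq_zero (by omega) (by omega) hΦ _ (congrArg _ hk) fun a ha => ?_
    obtain ⟨j, h1, h2, h3, rfl⟩ := exists_of_mem_eraseIdx_run _ ha
    exact Or.inr ⟨j, by omega, by omega, by omega, rfl⟩

theorem Alt_SIaux_zero_run : ∀ {n s l : ℕ} (_ : 1 ≤ s) (_ : s + n = k + 2)
    {Φ : TP (FF (2 * k + 4) (k + 2)) (n + 1) →ₗ[ℚ] TP (FF (2 * k + 4) (k + 2)) l}
    (_ : EquivariantUpTo s Φ),
    Alt (Φ (SIaux (n + 1) 0 (0 :: run (grho k) s n) (grho k (s + n))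
      (by rw [List.length_cons, length_run]))) = Alt (Φ (insertTensor (grho k) n s))
  | 0, s, _, hs, hk, Φ, _ => by
    have h : tCoef 0 0 (grho k s) = cls (grho k s) :=
      tCoef_zero_zero (grho_ne_zero hs (by omega))
    rw [insertTensor, ← h, SIaux, Fin.sum_univ_succ, Fin.sum_univ_zero, add_zero]
    rfl
  | n + 1, s, l, hs, hk, Φ, hΦ => by
    have ih := Alt_SIaux_zero_run (n := n) (s := s + 1) (by omega) (by omega)
      (hΦ.snoc_cls s.le_succ fun _ _ => swapAut_one_sub_div hs)
    have ih' := Alt_SIaux_run (n := n + 1) (s := s) hs (by omega)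
      (hΦ.snoc_cls le_rfl fun _ _ h => h s hs le_rfl)
    rw [LinearMap.comp_apply, LinearMap.comp_apply, LinearMap.flip_apply,
      LinearMap.flip_apply] at ih ih'
    rw [Nat.add_right_comm s 1 n] at ih
    rw [← add_assoc s n 1] at ih' ⊢
    rw [SIaux_zero_run_succ, map_add, map_add, map_sum, Alt_add, Alt_add, Alt_sum,
      Finset.sum_eq_zero, add_zero, tCoef_zero_grho hs (by omega),
      tCoef_zero_zero (grho_ne_zero hs (by omega)), ih, ih', insertTensor, map_add, Alt_add]
    intro i _
    obtain ⟨t, ht⟩ := Nat.exists_eq_add_of_le' (show 1 ≤ s + i by omega)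
    rw [ht]
    refine Alt_snoc_tCoef_eq_zero (by omega) (by omega) hΦ _ (congrArg _ hk) fun a ha => ?_
    rcases List.mem_cons.mp ha with rfl | ha
    · exact Or.inl rfl
    obtain ⟨j, h1, h2, h3, rfl⟩ := exists_of_mem_eraseIdx_run _ ha
    exact Or.inr ⟨j, by omega, by omega, by omega, rfl⟩

end Reduction

end Expansion

end GrassPoly

/-- for `m = k + 2 ≥ 2`,
`Alt_{2m} S I(0; 0, ρ₁, …, ρ_{m-1}; ρ_m) = Alt_{2m} [Σ_{j=1}^m w_j]`, where `w_j` is the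
elementary tensor whose `j`-th slot from the right is `[ρ_j]` and whose remaining slots,
left to right, are `[1 - ρ_m/ρ_{m-1}], …, [1 - ρ₂/ρ₁]`. -/
theorem symbol_expansion (k : ℕ) :
    Alt (SIaux (k + 2) 0
      (0 :: List.ofFn (fun t : Fin (k + 1) => grho k (t.val + 1)))
      (grho k (k + 2))
      (by rw [List.length_cons, List.length_ofFn])) =
    Alt (∑ j ∈ Finset.Icc 1 (k + 2),
      tprod ℚ (fun p : Fin (k + 2) =>
        if p.val + j = k + 2 then cls (grho k j)
        else
          cls (1 - grho k (k + 3 - (if p.val + j < k + 2 then p.val + 1 else p.val)) /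
            grho k (k + 2 - (if p.val + j < k + 2 then p.val + 1 else p.val))))) := by
  have hl : (0 :: List.ofFn fun t : Fin (k + 1) => grho k (t.val + 1)) =
      0 :: run (grho k) 1 (k + 1) := by
    refine congrArg _ (List.ext_getElem (by simp [run]) fun i _ _ => ?_)
    rw [List.getElem_ofFn]
    simp [run, add_comm]
  have h := Alt_SIaux_zero_run (k := k) (n := k + 1) (s := 1) le_rfl (by omega)
    (Φ := LinearMap.id) fun _ _ _ _ => rfl
  rw [LinearMap.id_apply, LinearMap.id_apply, insertTensor_eq_sum,
    show 1 + (k + 1) = k + 2 by omega] at h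
  rw [SIaux_congr _ _ hl _ (by rw [List.length_cons, length_run]), h]
  congr 1
  refine Finset.sum_nbij (· + 1) (fun j hj => ?_) (fun _ _ _ _ => Nat.succ_inj.mp)
    (fun j hj => ?_) fun j _ => ?_
  · rw [Finset.mem_range] at hj
    exact Finset.mem_Icc.mpr ⟨by omega, by omega⟩
  · rw [Finset.mem_coe, Finset.mem_Icc] at hj
    exact ⟨j - 1, Finset.mem_coe.mpr (Finset.mem_range.mpr (by omega)), by dsimp only; omega⟩
  · have hlt (p : ℕ) : (p + j < k + 1) = (p + (j + 1) < k + 2) := propext (by omega)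
    have heq (p : ℕ) : (p + j = k + 1) = (p + (j + 1) = k + 2) := propext (by omega)
    simp only [hlt, heq, add_comm 1 j]
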